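/- Let {X_t} be a stationary Markov chain on a finite set A = {1,...,n} with doublet frequency vector μ ∈ M_s(A²) satisfying μ_{ij} > 0 for all i, j, and let a_{ij} = μ_{ij}/μ̄_i. Then the M_s(A²)-valued process of cyclic empirical doublet measures {ν(x_1^l)} satisfies the large deviation property with rate function I(ν) = Σ_{i∈A} ν̄_i Σ_{j∈A} c_{ij} log(c_{ij}/a_{ij}), where c_{ij} = ν_{ij}/ν̄_i; equivalently, I(ν) = D_c(ν‖μ). That is, for every open Γ ⊆ M_s(A²), −inf_{ν∈Γ} I(ν) ≤ liminf_{l→∞} (1/l) log Pr{ν(x_1^l) ∈ Γ}, and for every closed Γ ⊆ M_s(A²), limsup_{l→∞} (1/l) log Pr{ν(x_1^l) ∈ Γ} ≤ −inf_{ν∈Γ} I(ν). -/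

import Mathlib

open Finset Filter

/-- Marginal of a doublet distribution. -/
def marg {n : ℕ} (ν : Fin n → Fin n → ℝ) : Fin n → ℝ := fun i => ∑ j, ν i j

def IsProb2 {n : ℕ} (ν : Fin n → Fin n → ℝ) : Prop :=
  (∀ i j, 0 ≤ ν i j) ∧ ∑ i, ∑ j, ν i j = 1

def IsStat2 {n : ℕ} (ν : Fin n → Fin n → ℝ) : Prop :=
  ∀ i, ∑ j, ν i j = ∑ j, ν j i

/-- The set `M_s(A²)` of stationary probability distributions on `A²`. -/
def Ms2 (n : ℕ) : Set (Fin n → Fin n → ℝ) := {ν | IsProb2 ν ∧ IsStat2 ν}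

/-- Relative entropy of doublet distributions. -/
noncomputable def DKL2 {n : ℕ} (ν μ : Fin n → Fin n → ℝ) : ℝ :=
  ∑ i, ∑ j, ν i j * Real.log (ν i j / μ i j)

/-- Relative entropy of probability vectors. -/
noncomputable def DKL1 {n : ℕ} (p q : Fin n → ℝ) : ℝ := ∑ i, p i * Real.log (p i / q i)

/-- Conditional relative entropy `D_c(ν‖μ) = D(ν‖μ) − D(ν̄‖μ̄)`. -/
noncomputable def Dc {n : ℕ} (ν μ : Fin n → Fin n → ℝ) : ℝ :=
  DKL2 ν μ - DKL1 (marg ν) (marg μ)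

/-- Cyclic empirical doublet measure of a sample path of length `l = m+1`. -/
noncomputable def emp2 {n m : ℕ} (x : Fin (m+1) → Fin n) : Fin n → Fin n → ℝ :=
  fun i j => (∑ t : Fin (m+1), if x t = i ∧ x (t+1) = j then (1:ℝ) else 0) / (m+1)

/-- Markov chain law on paths of length `l = m+1`. -/
noncomputable def pathP {n : ℕ} (μ : Fin n → Fin n → ℝ) {m : ℕ} (x : Fin (m+1) → Fin n) : ℝ :=
  marg μ (x 0) * ∏ t : Fin m, (μ (x t.castSucc) (x t.succ) / marg μ (x t.castSucc))

open scoped Classical in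
/-- `Pr{ν(x_1^l) ∈ Γ}`: probability of the set of sample paths of length `l = m+1`
whose cyclic empirical doublet measure lies in `Γ`. -/
noncomputable def prEvent {n : ℕ} (μ : Fin n → Fin n → ℝ) (m : ℕ)
    (Γ : Set (Fin n → Fin n → ℝ)) : ℝ :=
  ∑ x : Fin (m+1) → Fin n, if emp2 x ∈ Γ then pathP μ x else 0

/-- Extended-real logarithm, `elog p = −∞` for `p ≤ 0`. -/
noncomputable def elog (p : ℝ) : EReal := if p ≤ 0 then ⊥ else ((Real.log p : ℝ) : EReal)


/-- ℓ¹ (total variation) distance between doublet distributions. -/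
def dist1 {n : ℕ} (ν ξ : Fin n → Fin n → ℝ) : ℝ := ∑ i, ∑ j, |ν i j - ξ i j|

/-- `Γ` is open relative to `S` in the ℓ¹ metric. -/
def OpenIn {n : ℕ} (S Γ : Set (Fin n → Fin n → ℝ)) : Prop :=
  ∀ ζ ∈ Γ, ∃ ε > 0, ∀ ξ ∈ S, dist1 ξ ζ < ε → ξ ∈ Γ

/-- `Γ` is closed relative to `S` in the ℓ¹ metric. -/
def ClosedIn {n : ℕ} (S Γ : Set (Fin n → Fin n → ℝ)) : Prop := OpenIn S (S \ Γ)

/-- The rate function `I(ν) = Σ_i ν̄_i Σ_j c_{ij} log(c_{ij}/a_{ij})`, with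
`c_{ij} = ν_{ij}/ν̄_i` and `a_{ij} = μ_{ij}/μ̄_i`. -/
noncomputable def rate12 {n : ℕ} (μ ν : Fin n → Fin n → ℝ) : ℝ :=
  ∑ i, marg ν i *
    ∑ j, (ν i j / marg ν i) * Real.log ((ν i j / marg ν i) / (μ i j / marg μ i))

lemma marg_nonneg {n : ℕ} {ν : Fin n → Fin n → ℝ} (hν : ν ∈ Ms2 n) (i : Fin n) :
    0 ≤ marg ν i := Finset.sum_nonneg fun j _ => hν.1.1 i j

lemma marg_pos {n : ℕ} {ν : Fin n → Fin n → ℝ} (hpos : ∀ i j, 0 < ν i j) (i : Fin n) :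
    0 < marg ν i := Finset.sum_pos (fun j _ => hpos i j) ⟨i, Finset.mem_univ i⟩

lemma le_marg {n : ℕ} {ν : Fin n → Fin n → ℝ} (hν : ν ∈ Ms2 n) (i j : Fin n) :
    ν i j ≤ marg ν i :=
  Finset.single_le_sum (f := fun j => ν i j) (fun j _ => hν.1.1 i j) (Finset.mem_univ j)

/-- The rate function in a form that is visibly continuous. -/
noncomputable def rateSplit {n : ℕ} (μ ν : Fin n → Fin n → ℝ) : ℝ :=
  ∑ i, ∑ j, ν i j * Real.log (ν i j) - ∑ i, marg ν i * Real.log (marg ν i)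
    - ∑ i, ∑ j, ν i j * Real.log (μ i j / marg μ i)

lemma continuous_rateSplit {n : ℕ} (μ : Fin n → Fin n → ℝ) : Continuous (rateSplit μ) := by
  have hm : ∀ i, Continuous fun ν : Fin n → Fin n → ℝ => marg ν i := fun i => by
    unfold marg; fun_prop
  unfold rateSplit
  refine Continuous.sub (Continuous.sub ?_ ?_) ?_
  · exact continuous_finsetSum _ fun i _ => continuous_finsetSum _ fun j _ =>
      Real.continuous_mul_log.comp (by fun_prop : Continuous fun ν : Fin n → Fin n → ℝ => ν i j)
  · exact continuous_finsetSum _ fun i _ => Real.continuous_mul_log.comp (hm i)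
  · fun_prop

lemma rateSplit_eq_sum {n : ℕ} (μ ν : Fin n → Fin n → ℝ) :
    rateSplit μ ν = ∑ i, ∑ j, ν i j *
      (Real.log (ν i j) - Real.log (marg ν i) - Real.log (μ i j / marg μ i)) := by
  unfold rateSplit
  rw [← Finset.sum_sub_distrib, ← Finset.sum_sub_distrib]
  refine Finset.sum_congr rfl fun i _ => ?_
  conv_lhs => enter [1, 2, 1]; unfold marg
  rw [Finset.sum_mul, ← Finset.sum_sub_distrib, ← Finset.sum_sub_distrib]
  exact Finset.sum_congr rfl fun j _ => by ring

lemma rateSplit_eq_sum_log {n : ℕ} (μ : Fin n → Fin n → ℝ) {ν : Fin n → Fin n → ℝ}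
    (hν : ν ∈ Ms2 n) :
    rateSplit μ ν = ∑ i, ∑ j, ν i j *
      (Real.log (ν i j / marg ν i) - Real.log (μ i j / marg μ i)) := by
  rw [rateSplit_eq_sum]
  refine Finset.sum_congr rfl fun i _ => Finset.sum_congr rfl fun j _ => ?_
  rcases (hν.1.1 i j).eq_or_lt with h | h
  · simp [← h]
  · rw [Real.log_div h.ne' (h.trans_le (le_marg hν i j)).ne']

lemma rate12_eq_rateSplit {n : ℕ} {μ ν : Fin n → Fin n → ℝ} (hpos : ∀ i j, 0 < μ i j)
    (hν : ν ∈ Ms2 n) : rate12 μ ν = rateSplit μ ν := by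
  rw [rateSplit_eq_sum_log μ hν]
  unfold rate12
  refine Finset.sum_congr rfl fun i _ => ?_
  rw [Finset.mul_sum]
  refine Finset.sum_congr rfl fun j _ => ?_
  rcases (hν.1.1 i j).eq_or_lt with h | h
  · simp [← h]
  · have hm := h.trans_le (le_marg hν i j)
    rw [Real.log_div (div_pos h hm).ne' (div_pos (hpos i j) (marg_pos hpos i)).ne',
      ← mul_assoc, mul_div_cancel₀ _ hm.ne']

lemma Dc_eq_rateSplit {n : ℕ} {μ ν : Fin n → Fin n → ℝ} (hpos : ∀ i j, 0 < μ i j)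
    (hν : ν ∈ Ms2 n) : Dc ν μ = rateSplit μ ν := by
  rw [rateSplit_eq_sum]
  unfold Dc DKL2 DKL1
  rw [← Finset.sum_sub_distrib]
  refine Finset.sum_congr rfl fun i _ => ?_
  conv_lhs => enter [2, 1]; unfold marg
  rw [Finset.sum_mul, ← Finset.sum_sub_distrib]
  refine Finset.sum_congr rfl fun j _ => ?_
  rcases (hν.1.1 i j).eq_or_lt with h | h
  · simp [← h]
  · have hm := h.trans_le (le_marg hν i j)
    rw [Real.log_div h.ne' (hpos i j).ne', Real.log_div hm.ne' (marg_pos hpos i).ne',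
      Real.log_div (hpos i j).ne' (marg_pos hpos i).ne']
    ring


lemma mul_log_sub_gt {x y : ℝ} (hx : 0 < x) (hy : 0 < y) (hne : x ≠ y) :
    x - y < x * (Real.log x - Real.log y) := by
  have hne' : y / x ≠ 1 := fun h => hne ((div_eq_one_iff_eq hx.ne').1 h).symm
  have h := mul_lt_mul_of_pos_left (Real.log_lt_sub_one_of_pos (div_pos hy hx) hne') hx
  rw [Real.log_div hy.ne' hx.ne', mul_sub x (y / x), mul_div_cancel₀ _ hx.ne'] at h
  linarith

/-- A stationary doublet distribution with the transition probabilities of a positive one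
equals it. -/
lemma eq_of_same_transitions {n : ℕ} {μ ν : Fin n → Fin n → ℝ} (hμ : μ ∈ Ms2 n)
    (hpos : ∀ i j, 0 < μ i j) (hν : ν ∈ Ms2 n)
    (h : ∀ i j, ν i j = marg ν i * (μ i j / marg μ i)) : ν = μ := by
  set r : Fin n → ℝ := fun i => marg ν i / marg μ i with hr
  have hr' : ∀ i j, ν i j = r i * μ i j := fun i j => by rw [h i j, hr]; ring
  have hn : Nonempty (Fin n) := by
    by_contra hne
    rw [not_nonempty_iff] at hne
    have := hμ.1.2
    simp at this
  obtain ⟨j, hj⟩ := Finite.exists_max r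
  have hcol : ∑ i, (r j - r i) * μ i j = 0 := by
    have h1 : ∑ i, r i * μ i j = r j * marg μ j := by
      have := hν.2 j
      simp_rw [hr'] at this
      rw [← this, ← Finset.mul_sum]; rfl
    simp_rw [sub_mul, Finset.sum_sub_distrib, ← Finset.mul_sum, h1]
    rw [← hμ.2 j]; simp [marg]
  have hall : ∀ i, r i = r j := fun i => by
    have := (Finset.sum_eq_zero_iff_of_nonneg
      (fun i _ => mul_nonneg (sub_nonneg.2 (hj i)) (hpos i j).le)).1 hcol i (Finset.mem_univ i)
    have := (mul_eq_zero.1 this).resolve_right (hpos i j).ne'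
    linarith
  have hone : r j = 1 := by
    have := hν.1.2
    simp_rw [hr', hall, ← Finset.mul_sum, hμ.1.2, mul_one] at this
    exact this
  ext i k
  rw [hr', hall, hone, one_mul]

lemma rateSplit_pos {n : ℕ} {μ ν : Fin n → Fin n → ℝ} (hμ : μ ∈ Ms2 n)
    (hpos : ∀ i j, 0 < μ i j) (hν : ν ∈ Ms2 n) (hne : ν ≠ μ) : 0 < rateSplit μ ν := by
  set b : Fin n → Fin n → ℝ := fun i j => marg ν i * (μ i j / marg μ i) with hb
  have ha : ∀ i j, 0 < μ i j / marg μ i := fun i j => div_pos (hpos i j) (marg_pos hpos i)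
  have hterm : ∀ i j, ν i j ≠ b i j → ν i j - b i j < ν i j *
      (Real.log (ν i j) - Real.log (marg ν i) - Real.log (μ i j / marg μ i)) := by
    intro i j hij
    rcases (hν.1.1 i j).eq_or_lt with h | h
    · have : 0 ≤ b i j := mul_nonneg (marg_nonneg hν i) (ha i j).le
      rw [← h] at hij ⊢
      have := this.lt_of_ne hij
      linarith
    · have hm := h.trans_le (le_marg hν i j)
      have := mul_log_sub_gt h (mul_pos hm (ha i j)) hij
      rwa [Real.log_mul hm.ne' (ha i j).ne', ← sub_sub] at this
  have hle : ∀ i j, ν i j - b i j ≤ ν i j *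
      (Real.log (ν i j) - Real.log (marg ν i) - Real.log (μ i j / marg μ i)) := by
    intro i j
    by_cases hij : ν i j = b i j
    · rcases (hν.1.1 i j).eq_or_lt with h | h
      · simp [← hij, ← h]
      · have hm := h.trans_le (le_marg hν i j)
        rw [sub_sub, ← Real.log_mul hm.ne' (ha i j).ne', hij]
        simp [hb]
    · exact (hterm i j hij).le
  have hzero : ∑ i, ∑ j, (ν i j - b i j) = 0 := by
    refine Finset.sum_eq_zero fun i _ => ?_
    rw [Finset.sum_sub_distrib, hb, ← Finset.mul_sum, ← Finset.sum_div]
    change marg ν i - marg ν i * (marg μ i / marg μ i) = 0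
    rw [div_self (marg_pos hpos i).ne', mul_one, sub_self]
  obtain ⟨i, j, hij⟩ : ∃ i j, ν i j ≠ b i j := by
    by_contra! hc
    exact hne (eq_of_same_transitions hμ hpos hν hc)
  rw [rateSplit_eq_sum, ← hzero]
  exact Finset.sum_lt_sum (fun i _ => Finset.sum_le_sum fun j _ => hle i j)
    ⟨i, Finset.mem_univ i, Finset.sum_lt_sum (fun j _ => hle i j)
      ⟨j, Finset.mem_univ j, hterm i j hij⟩⟩

lemma emp2_nonneg {n m : ℕ} (x : Fin (m + 1) → Fin n) (i j : Fin n) : 0 ≤ emp2 x i j :=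
  div_nonneg (Finset.sum_nonneg fun t _ => by split_ifs <;> norm_num) (by positivity)

/-- The cyclic sum of a doublet functional is its empirical average times the length. -/
lemma sum_cyclic {n m : ℕ} (x : Fin (m + 1) → Fin n) (f : Fin n → Fin n → ℝ) :
    ∑ t, f (x t) (x (t + 1)) = ((m : ℝ) + 1) * ∑ i, ∑ j, emp2 x i j * f i j := by
  have hm : (m : ℝ) + 1 ≠ 0 := by positivity
  have h1 : ∀ i j, ((m : ℝ) + 1) * (emp2 x i j * f i j)
      = ∑ t, if x t = i ∧ x (t + 1) = j then f i j else 0 := fun i j => by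
    unfold emp2
    rw [← mul_assoc, mul_div_cancel₀ _ hm, Finset.sum_mul]
    exact Finset.sum_congr rfl fun t _ => by split_ifs <;> simp
  simp_rw [Finset.mul_sum, h1]
  simp_rw [Finset.sum_comm (s := (Finset.univ : Finset (Fin n)))
    (t := (Finset.univ : Finset (Fin (m + 1))))]
  refine Finset.sum_congr rfl fun t _ => ?_
  simp [ite_and]

lemma marg_emp2 {n m : ℕ} (x : Fin (m + 1) → Fin n) (i : Fin n) :
    marg (emp2 x) i = (∑ t, if x t = i then (1 : ℝ) else 0) / (m + 1) := by
  unfold marg emp2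
  rw [← Finset.sum_div, Finset.sum_comm]
  simp [ite_and]

lemma emp2_mem {n m : ℕ} (x : Fin (m + 1) → Fin n) : emp2 x ∈ Ms2 n := by
  have hm : (m : ℝ) + 1 ≠ 0 := by positivity
  refine ⟨⟨emp2_nonneg x, ?_⟩, fun i => ?_⟩
  · have := sum_cyclic x fun _ _ => 1
    simp only [Finset.sum_const, Finset.card_univ, Fintype.card_fin, nsmul_eq_mul, mul_one] at this
    push_cast at this
    exact mul_left_cancel₀ hm (by rw [← this, mul_one])
  · change marg (emp2 x) i = _
    rw [marg_emp2]
    unfold emp2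
    rw [← Finset.sum_div, Finset.sum_comm]
    congr 1
    rw [← Equiv.sum_comp (Equiv.addRight (1 : Fin (m + 1)))]
    refine Finset.sum_congr rfl fun t _ => ?_
    simp only [ite_and, Equiv.coe_addRight]
    by_cases h : x (t + 1) = i <;> simp [h]

lemma emp2_pos {n m : ℕ} (x : Fin (m + 1) → Fin n) (t : Fin (m + 1)) :
    0 < emp2 x (x t) (x (t + 1)) := by
  refine div_pos (Finset.sum_pos' (fun s _ => by split_ifs <;> norm_num)
    ⟨t, Finset.mem_univ t, by simp⟩) (by positivity)

lemma inv_le_marg_emp2 {n m : ℕ} (x : Fin (m + 1) → Fin n) :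
    ((m : ℝ) + 1)⁻¹ ≤ marg (emp2 x) (x 0) := by
  rw [marg_emp2, inv_eq_one_div]
  gcongr
  have := Finset.single_le_sum (f := fun t => if x t = x 0 then (1 : ℝ) else 0)
    (fun t _ => by split_ifs <;> norm_num) (Finset.mem_univ 0)
  simpa using this

/-- The path probability, closed up by one more transition, depends on the path only through
its initial state and its empirical doublet measure. -/
lemma pathP_mul_closing {n m : ℕ} (μ : Fin n → Fin n → ℝ) (x : Fin (m + 1) → Fin n)
    (hx : ∀ t, 0 < μ (x t) (x (t + 1)) / marg μ (x t)) :
    pathP μ x * (μ (x (Fin.last m)) (x 0) / marg μ (x (Fin.last m))) =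
      marg μ (x 0) * Real.exp (((m : ℝ) + 1) *
        ∑ i, ∑ j, emp2 x i j * Real.log (μ i j / marg μ i)) := by
  rw [← sum_cyclic x fun i j => Real.log (μ i j / marg μ i), Real.exp_sum]
  simp_rw [Real.exp_log (hx _)]
  rw [Fin.prod_univ_castSucc]
  simp only [Fin.coeSucc_eq_succ, Fin.last_add_one]
  unfold pathP
  ring

lemma transition_le_one {n : ℕ} {ν : Fin n → Fin n → ℝ} (hν : ν ∈ Ms2 n) (i j : Fin n) :
    ν i j / marg ν i ≤ 1 := div_le_one_of_le₀ (le_marg hν i j) (marg_nonneg hν i)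

lemma pathP_nonneg {n m : ℕ} {ν : Fin n → Fin n → ℝ} (hν : ν ∈ Ms2 n)
    (x : Fin (m + 1) → Fin n) : 0 ≤ pathP ν x :=
  mul_nonneg (marg_nonneg hν _) (Finset.prod_nonneg fun _ _ =>
    div_nonneg (hν.1.1 _ _) (marg_nonneg hν _))

lemma le_pathP {n m : ℕ} {ν : Fin n → Fin n → ℝ} (hν : ν ∈ Ms2 n) (x : Fin (m + 1) → Fin n)
    (hx : ∀ t, 0 < ν (x t) (x (t + 1)) / marg ν (x t)) :
    marg ν (x 0) * Real.exp (((m : ℝ) + 1) *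
      ∑ i, ∑ j, emp2 x i j * Real.log (ν i j / marg ν i)) ≤ pathP ν x := by
  rw [← pathP_mul_closing ν x hx]
  exact mul_le_of_le_one_right (pathP_nonneg hν x) (transition_le_one hν _ _)

lemma marg_le_one {n : ℕ} {ν : Fin n → Fin n → ℝ} (hν : ν ∈ Ms2 n) (i : Fin n) :
    marg ν i ≤ 1 := by
  rw [← hν.1.2]
  exact Finset.single_le_sum (f := marg ν) (fun i _ => marg_nonneg hν i) (Finset.mem_univ i)

lemma exists_pathP_le {n : ℕ} {μ : Fin n → Fin n → ℝ} (hμ : μ ∈ Ms2 n)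
    (hpos : ∀ i j, 0 < μ i j) : ∃ K : ℝ, 0 < K ∧ ∀ (m : ℕ) (x : Fin (m + 1) → Fin n),
      pathP μ x ≤ K * Real.exp (((m : ℝ) + 1) *
        ∑ i, ∑ j, emp2 x i j * Real.log (μ i j / marg μ i)) := by
  have ha : ∀ i j, 0 < μ i j / marg μ i := fun i j => div_pos (hpos i j) (marg_pos hpos i)
  obtain ⟨K, hK⟩ := Set.Finite.bddAbove
    (Set.finite_range fun p : Fin n × Fin n => (μ p.1 p.2 / marg μ p.1)⁻¹)
  refine ⟨max K 1, by positivity, fun m x => ?_⟩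
  have h := pathP_mul_closing μ x fun t => ha _ _
  rw [← eq_div_iff (ha _ _).ne'] at h
  rw [h, div_eq_inv_mul, ← mul_assoc]
  have hinv : (μ (x (Fin.last m)) (x 0) / marg μ (x (Fin.last m)))⁻¹ ≤ max K 1 :=
    (hK ⟨(x (Fin.last m), x 0), rfl⟩).trans (le_max_left _ _)
  gcongr
  exact (mul_le_of_le_one_right (inv_nonneg.2 (ha _ _).le) (marg_le_one hμ _)).trans hinv

lemma exists_le_pathP {n : ℕ} {μ : Fin n → Fin n → ℝ} (hμ : μ ∈ Ms2 n)
    (hpos : ∀ i j, 0 < μ i j) : ∃ k : ℝ, 0 < k ∧ ∀ (m : ℕ) (x : Fin (m + 1) → Fin n),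
      k * Real.exp (((m : ℝ) + 1) *
        ∑ i, ∑ j, emp2 x i j * Real.log (μ i j / marg μ i)) ≤ pathP μ x := by
  have ha : ∀ i j, 0 < μ i j / marg μ i := fun i j => div_pos (hpos i j) (marg_pos hpos i)
  obtain ⟨K, hK⟩ := Set.Finite.bddAbove (Set.finite_range fun i : Fin n => (marg μ i)⁻¹)
  refine ⟨(max K 1)⁻¹, by positivity, fun m x => le_trans ?_ (le_pathP hμ x fun t => ha _ _)⟩
  gcongr
  exact inv_le_of_inv_le₀ (marg_pos hpos _) ((hK ⟨x 0, rfl⟩).trans (le_max_left _ _))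

lemma pathP_snoc {n m : ℕ} (ν : Fin n → Fin n → ℝ) (y : Fin (m + 1) → Fin n) (k : Fin n) :
    pathP ν (Fin.snoc y k : Fin (m + 1 + 1) → Fin n) =
      pathP ν y * (ν (y (Fin.last m)) k / marg ν (y (Fin.last m))) := by
  have h0 : (Fin.snoc y k : Fin (m + 1 + 1) → Fin n) 0 = y 0 := by
    rw [← Fin.castSucc_zero, Fin.snoc_castSucc (α := fun _ => Fin n)]
  unfold pathP
  rw [Fin.prod_univ_castSucc, h0, mul_assoc]
  simp only [Fin.succ_castSucc, Fin.snoc_castSucc (α := fun _ => Fin n), Fin.succ_last,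
    Fin.snoc_last]

lemma sum_pathP_succ {n m : ℕ} (ν : Fin n → Fin n → ℝ) :
    ∑ x : Fin (m + 1 + 1) → Fin n, pathP ν x = ∑ y : Fin (m + 1) → Fin n,
      pathP ν y * (marg ν (y (Fin.last m)) / marg ν (y (Fin.last m))) := by
  rw [← Equiv.sum_comp (Fin.snocEquiv fun _ => Fin n), Fintype.sum_prod_type_right]
  refine Finset.sum_congr rfl fun y _ => ?_
  conv_rhs => enter [2, 1]; unfold marg
  rw [Finset.sum_div, Finset.mul_sum]
  exact Finset.sum_congr rfl fun k _ => pathP_snoc ν y k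

lemma sum_pathP_zero {n : ℕ} {ν : Fin n → Fin n → ℝ} (hν : ν ∈ Ms2 n) :
    ∑ x : Fin (0 + 1) → Fin n, pathP ν x = 1 := by
  change ∑ x : Fin 1 → Fin n, pathP (m := 0) ν x = 1
  rw [← hν.1.2, ← Equiv.sum_comp (Equiv.funUnique (Fin 1) (Fin n)).symm]
  exact Finset.sum_congr rfl fun i _ => by simp [pathP, marg]

lemma sum_pathP_le_one {n : ℕ} {ν : Fin n → Fin n → ℝ} (hν : ν ∈ Ms2 n) (m : ℕ) :
    ∑ x : Fin (m + 1) → Fin n, pathP ν x ≤ 1 := by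
  induction m with
  | zero => exact (sum_pathP_zero hν).le
  | succ m ih =>
    rw [sum_pathP_succ]
    exact (Finset.sum_le_sum fun y _ => mul_le_of_le_one_right (pathP_nonneg hν y)
      (div_self_le_one _)).trans ih

lemma sum_pathP_eq_one {n : ℕ} {ν : Fin n → Fin n → ℝ} (hν : ν ∈ Ms2 n)
    (hpos : ∀ i j, 0 < ν i j) (m : ℕ) : ∑ x : Fin (m + 1) → Fin n, pathP ν x = 1 := by
  induction m with
  | zero => exact sum_pathP_zero hν
  | succ m ih =>
    rw [sum_pathP_succ, ← ih]
    exact Finset.sum_congr rfl fun y _ => by rw [div_self (marg_pos hpos _).ne', mul_one]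

lemma exists_finset_emp2 (n m : ℕ) : ∃ T : Finset (Fin n → Fin n → ℝ), T.card ≤ (m + 2) ^ (n * n) ∧
    (∀ ν ∈ T, ν ∈ Ms2 n) ∧ ∀ x : Fin (m + 1) → Fin n, emp2 x ∈ T := by
  classical
  refine ⟨Finset.univ.image (emp2 (n := n) (m := m)), ?_, fun ν h => ?_, fun x =>
    Finset.mem_image_of_mem _ (Finset.mem_univ x)⟩
  · have hsub : Finset.univ.image (emp2 (n := n) (m := m)) ⊆
        (Finset.univ : Finset (Fin n → Fin n → Fin (m + 2))).image
          fun f i j => ((f i j : ℕ) : ℝ) / (m + 1) := by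
      intro ν h
      obtain ⟨x, -, rfl⟩ := Finset.mem_image.1 h
      refine Finset.mem_image.2 ⟨fun i j =>
        ⟨(Finset.univ.filter fun t => x t = i ∧ x (t + 1) = j).card, ?_⟩, Finset.mem_univ _, ?_⟩
      · exact (Finset.card_le_univ _).trans_lt (by simp)
      · ext i j
        simp [emp2]
    refine (Finset.card_le_card hsub).trans (Finset.card_image_le.trans ?_)
    simp [pow_mul]
  · obtain ⟨x, -, rfl⟩ := Finset.mem_image.1 h
    exact emp2_mem x

lemma sum_pathP_emp2_le (n m : ℕ) :
    ∑ x : Fin (m + 1) → Fin n, pathP (emp2 x) x ≤ ((m : ℝ) + 2) ^ (n * n) := by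
  obtain ⟨T, hcard, hT, hmem⟩ := exists_finset_emp2 n m
  calc ∑ x : Fin (m + 1) → Fin n, pathP (emp2 x) x
      ≤ ∑ x : Fin (m + 1) → Fin n, ∑ ν ∈ T, pathP ν x :=
        Finset.sum_le_sum fun x _ => Finset.single_le_sum (f := fun ν => pathP ν x)
          (fun ν hν => pathP_nonneg (hT ν hν) x) (hmem x)
    _ = ∑ ν ∈ T, ∑ x : Fin (m + 1) → Fin n, pathP ν x := Finset.sum_comm
    _ ≤ ∑ ν ∈ T, 1 := Finset.sum_le_sum fun ν hν => sum_pathP_le_one (hT ν hν) m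
    _ ≤ ((m : ℝ) + 2) ^ (n * n) := by
      simp only [Finset.sum_const, nsmul_eq_mul, mul_one]
      exact_mod_cast hcard

/-- Each path probability is bounded through the empirical chain of the path. -/
lemma exists_pathP_le_emp2 {n : ℕ} {μ : Fin n → Fin n → ℝ} (hμ : μ ∈ Ms2 n)
    (hpos : ∀ i j, 0 < μ i j) : ∃ K : ℝ, 0 < K ∧ ∀ (m : ℕ) (x : Fin (m + 1) → Fin n),
      pathP μ x ≤ K * ((m : ℝ) + 1) * Real.exp (-(((m : ℝ) + 1) * rateSplit μ (emp2 x))) *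
        pathP (emp2 x) x := by
  obtain ⟨K, hK, h⟩ := exists_pathP_le hμ hpos
  refine ⟨K, hK, fun m x => (h m x).trans ?_⟩
  have hm : (0 : ℝ) < m + 1 := by positivity
  have hlow := le_pathP (emp2_mem x) x fun t =>
    div_pos (emp2_pos x t) ((emp2_pos x t).trans_le (le_marg (emp2_mem x) _ _))
  have hlow' := (mul_le_mul_of_nonneg_right (inv_le_marg_emp2 x) (Real.exp_nonneg _)).trans hlow
  have hsplit : ∑ i, ∑ j, emp2 x i j * Real.log (μ i j / marg μ i) = -rateSplit μ (emp2 x) +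
      ∑ i, ∑ j, emp2 x i j * Real.log (emp2 x i j / marg (emp2 x) i) := by
    rw [rateSplit_eq_sum_log μ (emp2_mem x)]
    simp_rw [mul_sub, Finset.sum_sub_distrib]
    ring
  rw [hsplit, mul_add, Real.exp_add, mul_neg]
  calc _ = K * ((m : ℝ) + 1) * Real.exp (-(((m : ℝ) + 1) * rateSplit μ (emp2 x))) *
        (((m : ℝ) + 1)⁻¹ * Real.exp (((m : ℝ) + 1) *
          ∑ i, ∑ j, emp2 x i j * Real.log (emp2 x i j / marg (emp2 x) i))) := by
        field_simp
    _ ≤ _ := by gcongr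

/-- Nonasymptotic upper bound for events on which the rate function is at least `r`. -/
lemma exists_prEvent_le {n : ℕ} {μ : Fin n → Fin n → ℝ} (hμ : μ ∈ Ms2 n)
    (hpos : ∀ i j, 0 < μ i j) : ∃ K : ℝ, 0 < K ∧ ∀ (Γ : Set (Fin n → Fin n → ℝ)) (r : ℝ),
      (∀ ν ∈ Γ, ν ∈ Ms2 n → r ≤ rateSplit μ ν) → ∀ m : ℕ, prEvent μ m Γ ≤
        K * ((m : ℝ) + 2) ^ (n * n + 1) * Real.exp (-(((m : ℝ) + 1) * r)) := by
  obtain ⟨K, hK, h⟩ := exists_pathP_le_emp2 hμ hpos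
  refine ⟨K, hK, fun Γ r hr m => ?_⟩
  have hm : (0 : ℝ) < m + 1 := by positivity
  calc prEvent μ m Γ ≤ ∑ x : Fin (m + 1) → Fin n,
        K * ((m : ℝ) + 1) * Real.exp (-(((m : ℝ) + 1) * r)) * pathP (emp2 x) x := by
        refine Finset.sum_le_sum fun x _ => ?_
        have hx := pathP_nonneg (emp2_mem x) x
        split_ifs with hΓ
        · refine (h m x).trans ?_
          have := hr _ hΓ (emp2_mem x)
          gcongr
        · positivity
    _ = K * ((m : ℝ) + 1) * Real.exp (-(((m : ℝ) + 1) * r)) *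
        ∑ x : Fin (m + 1) → Fin n, pathP (emp2 x) x := by rw [Finset.mul_sum]
    _ ≤ K * ((m : ℝ) + 2) * Real.exp (-(((m : ℝ) + 1) * r)) * ((m : ℝ) + 2) ^ (n * n) := by
        have := sum_pathP_emp2_le n m
        have h0 : 0 ≤ ∑ x : Fin (m + 1) → Fin n, pathP (emp2 x) x :=
          Finset.sum_nonneg fun x _ => pathP_nonneg (emp2_mem x) x
        gcongr
        norm_num
    _ = _ := by ring

lemma tendsto_inv_mul_log (C : ℝ) (hC : 0 < C) (N : ℕ) :
    Tendsto (fun m : ℕ => ((m : ℝ) + 1)⁻¹ * Real.log (C * ((m : ℝ) + 2) ^ N)) atTop (nhds 0) := by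
  have h1 : Tendsto (fun m : ℕ => (m : ℝ) + 1) atTop atTop :=
    tendsto_atTop_add_const_right _ _ tendsto_natCast_atTop_atTop
  have h2 : Tendsto (fun m : ℕ => (m : ℝ) + 2) atTop atTop :=
    tendsto_atTop_add_const_right _ _ tendsto_natCast_atTop_atTop
  have h3 : Tendsto (fun m : ℕ => Real.log ((m : ℝ) + 2) / (1 * ((m : ℝ) + 2) + -1)) atTop
      (nhds 0) := by
    have := (Real.tendsto_pow_log_div_mul_add_atTop 1 (-1) 1 one_ne_zero).comp h2
    simpa [Function.comp_def] using this
  have h4 := ((h1.inv_tendsto_atTop).mul_const (Real.log C)).add (h3.const_mul (N : ℝ))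
  rw [zero_mul, mul_zero, add_zero] at h4
  refine h4.congr fun m => ?_
  have hm : (0 : ℝ) < m + 2 := by positivity
  rw [Real.log_mul hC.ne' (by positivity), Real.log_pow]
  have : (1 * ((m : ℝ) + 2) + -1) = m + 1 := by ring
  rw [this, Pi.inv_apply]
  ring

lemma tendsto_poly_mul_exp (C : ℝ) (N : ℕ) {η : ℝ} (hη : 0 < η) :
    Tendsto (fun m : ℕ => C * ((m : ℝ) + 2) ^ N * Real.exp (-(((m : ℝ) + 1) * η)))
      atTop (nhds 0) := by
  have h2 : Tendsto (fun m : ℕ => (m : ℝ) + 2) atTop atTop :=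
    tendsto_atTop_add_const_right _ _ tendsto_natCast_atTop_atTop
  have h := (((tendsto_rpow_mul_exp_neg_mul_atTop_nhds_zero (N : ℝ) η hη).comp h2).const_mul
    (C * Real.exp η))
  rw [mul_zero] at h
  refine h.congr fun m => ?_
  have : -(((m : ℝ) + 1) * η) = η + -η * ((m : ℝ) + 2) := by ring
  rw [this, Real.exp_add, Function.comp_apply, Real.rpow_natCast]
  ring

lemma limsup_prEvent_le {n : ℕ} {μ : Fin n → Fin n → ℝ} (hμ : μ ∈ Ms2 n)
    (hpos : ∀ i j, 0 < μ i j) {Γ : Set (Fin n → Fin n → ℝ)} {r : ℝ}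
    (hr : ∀ ν ∈ Γ, ν ∈ Ms2 n → r ≤ rateSplit μ ν) :
    limsup (fun m : ℕ => ((((m : ℝ) + 1)⁻¹ : ℝ) : EReal) * elog (prEvent μ m Γ)) atTop
      ≤ ((-r : ℝ) : EReal) := by
  obtain ⟨K, hK, h⟩ := exists_prEvent_le hμ hpos
  have hlim : Tendsto (fun m : ℕ => (((((m : ℝ) + 1)⁻¹ *
      Real.log (K * ((m : ℝ) + 2) ^ (n * n + 1)) - r : ℝ)) : EReal)) atTop
      (nhds ((-r : ℝ) : EReal)) := by
    refine (continuous_coe_real_ereal.tendsto _).comp ?_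
    simpa using (tendsto_inv_mul_log K hK (n * n + 1)).sub_const r
  rw [← hlim.limsup_eq]
  refine limsup_le_limsup (Eventually.of_forall fun m => ?_)
  have hm : (0 : ℝ) < m + 1 := by positivity
  dsimp only
  unfold elog
  split_ifs with hP
  · rw [EReal.coe_mul_bot_of_pos (by positivity)]
    exact bot_le
  · rw [not_le] at hP
    rw [← EReal.coe_mul, EReal.coe_le_coe_iff]
    have := Real.log_le_log hP (h Γ r hr m)
    rw [Real.log_mul (by positivity) (Real.exp_ne_zero _), Real.log_exp] at this
    calc ((m : ℝ) + 1)⁻¹ * Real.log (prEvent μ m Γ) ≤ ((m : ℝ) + 1)⁻¹ *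
        (Real.log (K * ((m : ℝ) + 2) ^ (n * n + 1)) + -(((m : ℝ) + 1) * r)) := by gcongr
      _ = _ := by field_simp; ring

lemma continuous_dist1 {n : ℕ} (ζ : Fin n → Fin n → ℝ) : Continuous fun ξ => dist1 ξ ζ := by
  unfold dist1; fun_prop

lemma isCompact_Ms2 (n : ℕ) : IsCompact (Ms2 n) := by
  have hcl : IsClosed (Ms2 n) := by
    have : Ms2 n = (⋂ i, ⋂ j, {ν : Fin n → Fin n → ℝ | 0 ≤ ν i j}) ∩ {ν | ∑ i, ∑ j, ν i j = 1} ∩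
        ⋂ i, {ν | ∑ j, ν i j = ∑ j, ν j i} := by
      ext ν
      simp [Ms2, IsProb2, IsStat2]
    rw [this]
    refine IsClosed.inter (IsClosed.inter ?_ ?_) ?_
    · exact isClosed_iInter fun i => isClosed_iInter fun j =>
        isClosed_le continuous_const (by fun_prop)
    · exact isClosed_eq (by fun_prop) continuous_const
    · exact isClosed_iInter fun i => isClosed_eq (by fun_prop) (by fun_prop)
  refine IsCompact.of_isClosed_subset (isCompact_Icc (a := fun _ _ => (0 : ℝ))
    (b := fun _ _ => (1 : ℝ))) hcl fun ν hν => ⟨fun i j => hν.1.1 i j, fun i j =>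
      (le_marg hν i j).trans (marg_le_one hν i)⟩

/-- Law of large numbers: the empirical measure lies near the doublet law of the chain. -/
lemma eventually_half_le_prEvent {n : ℕ} {μ : Fin n → Fin n → ℝ} (hμ : μ ∈ Ms2 n)
    (hpos : ∀ i j, 0 < μ i j) {U : Set (Fin n → Fin n → ℝ)} (hU : IsOpen U) (hμU : μ ∈ U) :
    ∀ᶠ m : ℕ in atTop, 1 / 2 ≤ prEvent μ m U := by
  obtain ⟨η, hη, hmin⟩ : ∃ η : ℝ, 0 < η ∧ ∀ ν ∈ Uᶜ, ν ∈ Ms2 n → η ≤ rateSplit μ ν := by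
    rcases (Ms2 n \ U).eq_empty_or_nonempty with h | h
    · refine ⟨1, one_pos, fun ν hν hs => ?_⟩
      have : ν ∈ Ms2 n \ U := ⟨hs, hν⟩
      simp [h] at this
    · obtain ⟨ν₀, hν₀, hmin⟩ := ((isCompact_Ms2 n).diff hU).exists_isMinOn h
        (continuous_rateSplit μ).continuousOn
      exact ⟨_, rateSplit_pos hμ hpos hν₀.1 fun h => hν₀.2 (h ▸ hμU),
        fun ν hν hs => hmin ⟨hs, hν⟩⟩
  obtain ⟨K, hK, h⟩ := exists_prEvent_le hμ hpos
  filter_upwards [(tendsto_poly_mul_exp K (n * n + 1) hη).eventually_le_const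
    (by norm_num : (0 : ℝ) < 1 / 2)] with m hm
  have hsum : prEvent μ m U + prEvent μ m Uᶜ = 1 := by
    rw [← sum_pathP_eq_one hμ hpos m]
    unfold prEvent
    rw [← Finset.sum_add_distrib]
    refine Finset.sum_congr rfl fun x _ => ?_
    by_cases hx : emp2 x ∈ U <;> simp [hx]
  linarith [h Uᶜ η hmin m]

/-- Change of measure: lower bound through a positive stationary doublet law in `Γ`. -/
lemma exists_le_prEvent {n : ℕ} {μ ν : Fin n → Fin n → ℝ} (hμ : μ ∈ Ms2 n)
    (hpos : ∀ i j, 0 < μ i j) (hν : ν ∈ Ms2 n) (hνpos : ∀ i j, 0 < ν i j)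
    {Γ : Set (Fin n → Fin n → ℝ)} (hΓ : OpenIn (Ms2 n) Γ) (hνΓ : ν ∈ Γ) {r : ℝ}
    (hr : rateSplit μ ν < r) :
    ∃ k : ℝ, 0 < k ∧ ∀ᶠ m : ℕ in atTop,
      k * Real.exp (-(((m : ℝ) + 1) * r)) ≤ prEvent μ m Γ := by
  obtain ⟨ε, hε, hball⟩ := hΓ ν hνΓ
  set L : (Fin n → Fin n → ℝ) → ℝ := fun ξ => ∑ i, ∑ j, ξ i j *
    (Real.log (ν i j / marg ν i) - Real.log (μ i j / marg μ i)) with hL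
  set U : Set (Fin n → Fin n → ℝ) := {ξ | dist1 ξ ν < ε} ∩ {ξ | L ξ < r}
  have hU : IsOpen U := (isOpen_lt (continuous_dist1 ν) continuous_const).inter
    (isOpen_lt (by rw [hL]; fun_prop) continuous_const)
  have hνU : ν ∈ U := ⟨by simpa [dist1] using hε, by
    change L ν < r
    rwa [rateSplit_eq_sum_log μ hν] at hr⟩
  obtain ⟨k, hk, hlow⟩ := exists_le_pathP hμ hpos
  obtain ⟨K, hK, hupp⟩ := exists_pathP_le hν hνpos
  refine ⟨k / K * (1 / 2), by positivity, ?_⟩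
  filter_upwards [eventually_half_le_prEvent hν hνpos hU hνU] with m hm
  have hm1 : (0 : ℝ) < m + 1 := by positivity
  calc k / K * (1 / 2) * Real.exp (-(((m : ℝ) + 1) * r))
      ≤ k / K * prEvent ν m U * Real.exp (-(((m : ℝ) + 1) * r)) := by gcongr
    _ ≤ prEvent μ m Γ := by
        unfold prEvent
        rw [mul_right_comm, Finset.mul_sum]
        refine Finset.sum_le_sum fun x _ => ?_
        by_cases hx : emp2 x ∈ U
        · rw [if_pos hx, if_pos (hball _ (emp2_mem x) hx.1)]
          refine le_trans ?_ (hlow m x)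
          have hLx : L (emp2 x) ≤ r := hx.2.le
          have hsplit : ∑ i, ∑ j, emp2 x i j * Real.log (μ i j / marg μ i) =
              -L (emp2 x) + ∑ i, ∑ j, emp2 x i j * Real.log (ν i j / marg ν i) := by
            simp_rw [hL, mul_sub, Finset.sum_sub_distrib]
            ring
          rw [hsplit, mul_add, Real.exp_add, mul_neg]
          calc _ ≤ k / K * Real.exp (-(((m : ℝ) + 1) * L (emp2 x))) *
                (K * Real.exp (((m : ℝ) + 1) *
                  ∑ i, ∑ j, emp2 x i j * Real.log (ν i j / marg ν i))) := by
                have := hupp m x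
                have := pathP_nonneg hν x
                gcongr
            _ = _ := by field_simp
        · rw [if_neg hx, mul_zero]
          split_ifs
          · exact pathP_nonneg hμ x
          · exact le_rfl

lemma exists_pos_near {n : ℕ} {μ ν : Fin n → Fin n → ℝ} (hμ : μ ∈ Ms2 n)
    (hpos : ∀ i j, 0 < μ i j) (hν : ν ∈ Ms2 n) {U : Set (Fin n → Fin n → ℝ)} (hU : IsOpen U)
    (hνU : ν ∈ U) : ∃ ξ ∈ U, ξ ∈ Ms2 n ∧ ∀ i j, 0 < ξ i j := by
  set F : ℝ → Fin n → Fin n → ℝ := fun s i j => (1 - s) * ν i j + s * μ i j with hF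
  have hcont : Continuous F := by
    rw [hF]; fun_prop
  have hmem : ∀ᶠ s in nhdsWithin (0 : ℝ) (Set.Ioi 0), F s ∈ U :=
    nhdsWithin_le_nhds (hcont.continuousAt.preimage_mem_nhds
      (hU.mem_nhds (by simpa [hF] using hνU)))
  obtain ⟨s, hsU, hs0, hs1⟩ := (hmem.and (Ioo_mem_nhdsGT (zero_lt_one' ℝ))).exists
  have hFpos : ∀ i j, 0 < F s i j := fun i j =>
    add_pos_of_nonneg_of_pos (mul_nonneg (sub_nonneg.2 hs1.le) (hν.1.1 i j))
      (mul_pos hs0 (hpos i j))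
  refine ⟨F s, hsU, ⟨⟨fun i j => (hFpos i j).le, ?_⟩, fun i => ?_⟩, hFpos⟩
  · simp_rw [hF, Finset.sum_add_distrib, ← Finset.mul_sum, hμ.1.2, hν.1.2]
    ring
  · simp_rw [hF, Finset.sum_add_distrib, ← Finset.mul_sum, hμ.2 i, hν.2 i]

lemma le_liminf_prEvent {n : ℕ} {μ ν : Fin n → Fin n → ℝ} (hμ : μ ∈ Ms2 n)
    (hpos : ∀ i j, 0 < μ i j) (hν : ν ∈ Ms2 n) {Γ : Set (Fin n → Fin n → ℝ)}
    (hΓ : OpenIn (Ms2 n) Γ) (hνΓ : ν ∈ Γ) {r : ℝ} (hr : rateSplit μ ν < r) :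
    ((-r : ℝ) : EReal) ≤
      liminf (fun m : ℕ => ((((m : ℝ) + 1)⁻¹ : ℝ) : EReal) * elog (prEvent μ m Γ)) atTop := by
  obtain ⟨ε, hε, hball⟩ := hΓ ν hνΓ
  obtain ⟨ξ, ⟨hξε, hξr⟩, hξ, hξpos⟩ := exists_pos_near hμ hpos hν
    ((isOpen_lt (continuous_dist1 ν) continuous_const).inter
      (isOpen_lt (continuous_rateSplit μ) continuous_const))
    (show ν ∈ {ξ | dist1 ξ ν < ε} ∩ {ξ | rateSplit μ ξ < r} from
      ⟨by simpa [dist1] using hε, hr⟩)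
  obtain ⟨k, hk, h⟩ := exists_le_prEvent hμ hpos hξ hξpos hΓ (hball ξ hξ hξε) hξr
  have hlim : Tendsto (fun m : ℕ => (((((m : ℝ) + 1)⁻¹ * Real.log k - r : ℝ)) : EReal)) atTop
      (nhds ((-r : ℝ) : EReal)) := by
    refine (continuous_coe_real_ereal.tendsto _).comp ?_
    simpa using (tendsto_inv_mul_log k hk 0).sub_const r
  rw [← hlim.liminf_eq]
  refine liminf_le_liminf (h.mono fun m hm => ?_)
  have hm1 : (0 : ℝ) < m + 1 := by positivity
  have hlow : 0 < k * Real.exp (-(((m : ℝ) + 1) * r)) := by positivity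
  unfold elog
  rw [if_neg (hlow.trans_le hm).not_ge, ← EReal.coe_mul, EReal.coe_le_coe_iff]
  have := Real.log_le_log hlow hm
  rw [Real.log_mul hk.ne' (Real.exp_ne_zero _), Real.log_exp] at this
  calc _ = ((m : ℝ) + 1)⁻¹ * (Real.log k + -(((m : ℝ) + 1) * r)) := by field_simp; ring
    _ ≤ _ := by gcongr

/-- For a stationary Markov chain with strictly positive doublet
frequency vector `μ ∈ M_s(A²)` and `a_{ij} = μ_{ij}/μ̄_i`, the process of cyclic
empirical doublet measures satisfies the LDP with rate function
`I(ν) = Σ_i ν̄_i Σ_j c_{ij} log(c_{ij}/a_{ij})`, which equals `D_c(ν‖μ)`: for every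
open `Γ ⊆ M_s(A²)`, `−inf_Γ I ≤ liminf (1/l) log Pr{ν(x_1^l) ∈ Γ}`, and for every
closed `Γ ⊆ M_s(A²)`, `limsup (1/l) log Pr{ν(x_1^l) ∈ Γ} ≤ −inf_Γ I`. -/
theorem stmt12 {n : ℕ} (μ : Fin n → Fin n → ℝ)
    (hμ : μ ∈ Ms2 n) (hpos : ∀ i j, 0 < μ i j) :
    (∀ ν ∈ Ms2 n, rate12 μ ν = Dc ν μ) ∧
    (∀ Γ : Set (Fin n → Fin n → ℝ), Γ ⊆ Ms2 n → OpenIn (Ms2 n) Γ →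
      -(⨅ ν ∈ Γ, ((rate12 μ ν : ℝ) : EReal))
        ≤ Filter.liminf
            (fun m : ℕ => ((((m:ℝ)+1)⁻¹ : ℝ) : EReal) * elog (prEvent μ m Γ))
            Filter.atTop) ∧
    (∀ Γ : Set (Fin n → Fin n → ℝ), Γ ⊆ Ms2 n → ClosedIn (Ms2 n) Γ →
      Filter.limsup
          (fun m : ℕ => ((((m:ℝ)+1)⁻¹ : ℝ) : EReal) * elog (prEvent μ m Γ))
          Filter.atTop
        ≤ -(⨅ ν ∈ Γ, ((rate12 μ ν : ℝ) : EReal))) := by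
  refine ⟨fun ν hν => by rw [rate12_eq_rateSplit hpos hν, Dc_eq_rateSplit hpos hν],
    fun Γ hΓs hΓ => ?_, fun Γ hΓs _ => ?_⟩
  · rw [EReal.neg_le]
    refine le_iInf₂ fun ν hνΓ => ?_
    rw [rate12_eq_rateSplit hpos (hΓs hνΓ)]
    refine EReal.le_of_forall_lt_iff_le.1 fun r hr => ?_
    have := le_liminf_prEvent hμ hpos (hΓs hνΓ) hΓ hνΓ (EReal.coe_lt_coe_iff.1 hr)
    rw [EReal.neg_le]
    exact_mod_cast this
  · rw [EReal.le_neg]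
    refine EReal.ge_of_forall_gt_iff_ge.1 fun r hr => ?_
    have := limsup_prEvent_le hμ hpos (Γ := Γ) (r := r) fun ν hνΓ hν => by
      rw [← rate12_eq_rateSplit hpos hν]
      exact EReal.coe_le_coe_iff.1 (hr.le.trans (iInf₂_le ν hνΓ))
    rw [EReal.le_neg]
    exact_mod_cast this
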